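/- Let κ ≥ 2 be an integer, let X ⊆ {1,…,κ}^ℕ be a topologically mixing subshift of finite type, and let σ : X → X be the left shift. Let ℰ_σ ⊆ X be the set of points x ∈ X at which the pointwise emergence of σ is super-polynomial, i.e. limsup_{ε→0⁺} log ℰ_{σ,x}(ε)/(−log ε) = ∞. Then the topological entropy of σ restricted to ℰ_σ equals the topological entropy of σ on X: h_top(σ|_{ℰ_σ}) = h_top(σ|_X). -/

import Mathlib

open MeasureTheory Filter Set

/-- The first Wasserstein distance between two Borel probability measures on a metric
space: the infimum of `∫ d(x,y) dP` over all couplings `P` of the two measures. -/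
noncomputable def wassersteinDist {M : Type*} [MetricSpace M] [MeasurableSpace M]
    (μ ν : Measure M) : ℝ :=
  sInf { r : ℝ | ∃ P : Measure (M × M), IsProbabilityMeasure P ∧
    P.map Prod.fst = μ ∧ P.map Prod.snd = ν ∧ r = ∫ p, dist p.1 p.2 ∂P }

/-- The `n`-th empirical measure `δ_x^n = (1/n) ∑_{k<n} δ_{f^k x}` of the point `x`. -/
noncomputable def empiricalMeasure {M : Type*} [MetricSpace M] [MeasurableSpace M]
    (f : M → M) (x : M) (n : ℕ) : Measure M :=
  (n : ENNReal)⁻¹ • ∑ k ∈ Finset.range n, Measure.dirac (f^[k] x)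

/-- The pointwise emergence `ℰ_{f,x}(ε)`: the least `N ≥ 1` such that there are Borel
probability measures `μ_1, …, μ_N` with
`limsup_{n→∞} min_{1≤j≤N} d_W(δ_x^n, μ_j) ≤ ε`. -/
noncomputable def pointwiseEmergence {M : Type*} [MetricSpace M] [MeasurableSpace M]
    (f : M → M) (x : M) (ε : ℝ) : ℕ :=
  sInf { N : ℕ | 0 < N ∧ ∃ μs : Fin N → Measure M, (∀ j, IsProbabilityMeasure (μs j)) ∧
    Filter.limsup (fun n : ℕ => ⨅ j, wassersteinDist (empiricalMeasure f x n) (μs j))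
      Filter.atTop ≤ ε }

/-- The pointwise emergence of `f` at `x` is super-polynomial:
`limsup_{ε→0⁺} log ℰ_{f,x}(ε) / (−log ε) = ∞`. -/
def superPolynomialEmergence {M : Type*} [MetricSpace M] [MeasurableSpace M]
    (f : M → M) (x : M) : Prop :=
  Filter.limsup
    (fun ε : ℝ => ((Real.log (pointwiseEmergence f x ε) / (-Real.log ε) : ℝ) : EReal))
    (nhdsWithin 0 (Set.Ioi 0)) = ⊤

/-- The Bowen ball `B_n(x, ε) = { y : d(f^k x, f^k y) < ε for all k < n }`. -/
def bowenBall {M : Type*} [MetricSpace M] (f : M → M) (x : M) (n : ℕ) (ε : ℝ) : Set M :=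
  { y | ∀ k < n, dist (f^[k] x) (f^[k] y) < ε }

/-- Bowen's outer quantity `m(S, s, ε)`: the limit as `N → ∞` of the infimum, over countable
covers of `S` by Bowen balls `B_{n_i}(x_i, ε)` with `n_i ≥ N`, of `∑ exp(−s n_i)`. -/
noncomputable def bowenPreMeasure {M : Type*} [MetricSpace M] (f : M → M) (S : Set M)
    (s ε : ℝ) : ENNReal :=
  ⨆ N : ℕ, ⨅ (I : Set (M × ℕ)) (_ : I.Countable) (_ : ∀ p ∈ I, N ≤ p.2)
      (_ : S ⊆ ⋃ p ∈ I, bowenBall f p.1 p.2 ε),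
    ∑' p : I, ENNReal.ofReal (Real.exp (-(s * ((p : M × ℕ).2 : ℝ))))

/-- Bowen's topological entropy of `f` restricted to a (not necessarily compact or invariant)
set `S`, defined via dynamical covers: `lim_{ε→0} inf { s : m(S, s, ε) = 0 }`. -/
noncomputable def bowenEntropy {M : Type*} [MetricSpace M] (f : M → M) (S : Set M) : ENNReal :=
  ⨆ (ε : ℝ) (_ : 0 < ε), ⨅ (s : NNReal) (_ : bowenPreMeasure f S s ε = 0), (s : ENNReal)

attribute [local instance] PiNat.metricSpace

/-- `x` is a path for the transition matrix `A`. -/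
def Admissible {κ : ℕ} (A : Matrix (Fin κ) (Fin κ) ℕ) (x : ℕ → Fin κ) : Prop :=
  ∀ n, A (x n) (x (n + 1)) = 1

/-- Any two symbols are joined by an admissible path with exactly `N` steps. -/
def ConnectsIn {κ : ℕ} (A : Matrix (Fin κ) (Fin κ) ℕ) (N : ℕ) : Prop :=
  ∀ i j, ∃ w : ℕ → Fin κ, w 0 = i ∧ w N = j ∧ ∀ l < N, A (w l) (w (l + 1)) = 1

theorem connectsIn_of_pow_pos {κ : ℕ} {A : Matrix (Fin κ) (Fin κ) ℕ}
    (hA : ∀ i j, A i j = 0 ∨ A i j = 1) {n : ℕ} (h : ∀ i j, 0 < (A ^ n) i j) :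
    ConnectsIn A n := by
  have key : ∀ n : ℕ, ∀ i j, 0 < (A ^ n) i j →
      ∃ w : ℕ → Fin κ, w 0 = i ∧ w n = j ∧ ∀ l < n, A (w l) (w (l + 1)) = 1 := by
    intro n
    induction n with
    | zero =>
      intro i j hij
      have : i = j := by
        by_contra hne
        simp [hne] at hij
      exact ⟨fun _ => i, rfl, this, fun l hl => absurd hl (Nat.not_lt_zero l)⟩
    | succ n ih =>
      intro i j hij
      rw [pow_succ, Matrix.mul_apply] at hij
      obtain ⟨k, -, hk⟩ := Finset.exists_ne_zero_of_sum_ne_zero hij.ne'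
      have h1 : (A ^ n) i k ≠ 0 := left_ne_zero_of_mul hk
      have h2 : A k j = 1 := (hA k j).resolve_left (right_ne_zero_of_mul hk)
      obtain ⟨w, h0, hn, hw⟩ := ih i k (Nat.pos_of_ne_zero h1)
      refine ⟨fun l => if l ≤ n then w l else j, by simpa using h0, by simp, ?_⟩
      intro l hl
      rcases Nat.lt_succ_iff_lt_or_eq.mp hl with h | h
      · have h' : l + 1 ≤ n := h
        simpa [h.le, h'] using hw l h
      · subst h
        simpa [hn] using h2
  exact fun i j => key n i j (h i j)

theorem Admissible.shift {κ : ℕ} {A : Matrix (Fin κ) (Fin κ) ℕ} {x : ℕ → Fin κ}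
    (hx : Admissible A x) (n : ℕ) : Admissible A (fun l => x (n + l)) :=
  fun l => hx (n + l)

/-- Follow `p` up to time `n` and then, after a connection of length `N`, follow `r`. -/
theorem Admissible.exists_splice {κ : ℕ} {A : Matrix (Fin κ) (Fin κ) ℕ} {N : ℕ} (hN : 1 ≤ N)
    (hc : ConnectsIn A N) {p r : ℕ → Fin κ} (hp : Admissible A p) (hr : Admissible A r) (n : ℕ) :
    ∃ z, Admissible A z ∧ (∀ l ≤ n, z l = p l) ∧ ∀ l, z (n + N + l) = r l := by
  obtain ⟨w, h0, h1, hw⟩ := hc (p n) (r 0)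
  let z : ℕ → Fin κ := fun l =>
    if l ≤ n then p l else if l < n + N then w (l - n) else r (l - n - N)
  have zl : ∀ l ≤ n, z l = p l := fun l hl => by simp [z, hl]
  have zm : ∀ l ≤ N, z (n + l) = w l := by
    intro l hl
    rcases Nat.eq_zero_or_pos l with h | h
    · subst h; simp [z, h0]
    · rcases hl.lt_or_eq with h' | h'
      · simp [z, h', h.ne']
      · subst h'; simp [z, h.ne', h1]
  have zr : ∀ l, z (n + N + l) = r l := by
    intro l
    have e1 : ¬ (n + N + l ≤ n) := by omega
    have e2 : ¬ (n + N + l < n + N) := by omega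
    have e3 : n + N + l - n - N = l := by omega
    simp [z, e1, e2, e3]
  refine ⟨z, ?_, zl, zr⟩
  intro l
  rcases lt_or_ge l n with h | h
  · rw [zl l h.le, zl (l + 1) h]; exact hp l
  · obtain ⟨k, rfl⟩ := Nat.exists_eq_add_of_le h
    rcases lt_or_ge k N with h' | h'
    · rw [zm k h'.le, add_assoc, zm (k + 1) h']; exact hw k h'
    · obtain ⟨k', rfl⟩ := Nat.exists_eq_add_of_le h'
      rw [← add_assoc, zr, add_assoc, zr]; exact hr k'

theorem exists_periodic_admissible {κ : ℕ} (hκ : 2 ≤ κ) {A : Matrix (Fin κ) (Fin κ) ℕ} {N : ℕ}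
    (hN : 1 ≤ N) (hc : ∀ n, N ≤ n → ConnectsIn A n) {p : ℕ} (hp : 2 * N ≤ p) :
    ∃ y, Admissible A y ∧ Function.Periodic y p ∧ ¬ Function.Periodic y 1 := by
  let i : Fin κ := ⟨0, by omega⟩
  let k : Fin κ := ⟨1, by omega⟩
  have hik : i ≠ k := by simp [i, k]
  obtain ⟨u, u0, uN, hu⟩ := hc N le_rfl i k
  obtain ⟨v, v0, vN, hv⟩ := hc (p - N) (by omega) k i
  let w : ℕ → Fin κ := fun l => if l < N then u l else v (l - N)
  have hwp : w p = i := by simp [w, show ¬ p < N by omega, vN]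
  have hw0 : w 0 = i := by simp [w, show 0 < N by omega, u0]
  have hwN : w N = k := by simp [w, v0]
  have hw : ∀ l < p, A (w l) (w (l + 1)) = 1 := by
    intro l hl
    rcases lt_trichotomy (l + 1) N with h | h | h
    · simpa [w, h, show l < N by omega] using hu l (by omega)
    · have : w (l + 1) = u (l + 1) := by rw [h, hwN, uN]
      rw [this]
      simpa [w, show l < N by omega] using hu l (by omega)
    · have := hv (l - N) (by omega)
      rw [show l - N + 1 = l + 1 - N by omega] at this
      simpa [w, show ¬ l < N by omega, show ¬ l + 1 < N by omega] using this
  refine ⟨fun n => w (n % p), ?_, ?_, ?_⟩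
  · intro n
    have hlt : n % p < p := Nat.mod_lt _ (by omega)
    have := hw (n % p) hlt
    show A (w (n % p)) (w ((n + 1) % p)) = 1
    have e : (n + 1) % p = (n % p + 1) % p := by simp
    rcases (show n % p + 1 ≤ p from hlt).lt_or_eq with h | h
    · rw [e, Nat.mod_eq_of_lt h]; exact this
    · rw [h, hwp] at this; rw [e, h, Nat.mod_self, hw0]; exact this
  · intro n
    simp
  · intro h
    have := h.nat_mul N 0
    simp only [Nat.cast_id, mul_one, zero_add, Nat.zero_mod, hw0] at this
    rw [Nat.mod_eq_of_lt (by omega), hwN] at this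
    exact hik this.symm

theorem Function.Periodic.one_of_coprime {α : Type*} {f : ℕ → α} {p q : ℕ}
    (hp : Function.Periodic f p) (hq : Function.Periodic f q) (h : Nat.Coprime p q)
    (hq1 : 1 < q) : Function.Periodic f 1 := by
  obtain ⟨a, -, ha⟩ := Nat.exists_mul_mod_eq_one_of_coprime h hq1
  intro n
  have e : n + a * p = (n + 1) + (p * a / q) * q := by
    have := Nat.div_add_mod (p * a) q
    rw [ha] at this
    linarith [mul_comm a p, mul_comm q (p * a / q)]
  have h1 := hp.nat_mul a n
  have h2 := hq.nat_mul (p * a / q) (n + 1)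
  simp only [Nat.cast_id] at h1 h2
  rw [← h2, ← e, h1]

/-- A sequence of periodic points whose orbits are pairwise disjoint, uniformly so among
finitely many of them. -/
theorem exists_disjoint_periodic_family {κ : ℕ} (hκ : 2 ≤ κ) {A : Matrix (Fin κ) (Fin κ) ℕ}
    {N : ℕ} (hN : 1 ≤ N) (hc : ∀ n, N ≤ n → ConnectsIn A n) :
    ∃ y : ℕ → ℕ → Fin κ, (∀ i, Admissible A (y i)) ∧
      ∀ d, ∃ m, ∀ i ≤ d, ∀ j ≤ d, i ≠ j → ∀ n n', ∃ l < m, y i (n + l) ≠ y j (n' + l) := by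
  let p : ℕ → ℕ := fun i => Nat.nth Nat.Prime (i + 2 * N)
  have hinf := Nat.infinite_setOfPred_prime
  have hpp : ∀ i, (p i).Prime := fun i => Nat.nth_mem_of_infinite hinf _
  have hpl : ∀ i, 2 * N ≤ p i := fun i =>
    le_trans (Nat.le_add_left _ i) ((Nat.nth_strictMono hinf).le_apply)
  have hpi : ∀ i j, i ≠ j → p i ≠ p j := by
    intro i j hij h
    have := Nat.nth_injective hinf h
    omega
  choose y hy hper hnc using fun i => exists_periodic_admissible hκ hN hc (hpl i)
  refine ⟨y, hy, fun d => ⟨∏ i ∈ Finset.range (d + 1), p i, ?_⟩⟩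
  intro i hi j hj hij n n'
  by_contra! hcon
  set m := ∏ i ∈ Finset.range (d + 1), p i with hm
  have hmpos : 0 < m := Finset.prod_pos fun i _ => (hpp i).pos
  have hmper : ∀ i ≤ d, Function.Periodic (y i) m := by
    intro i hi
    obtain ⟨c, hc⟩ := Finset.dvd_prod_of_mem p (Finset.mem_range.mpr (Nat.lt_succ_of_le hi))
    rw [hm, hc, mul_comm]
    exact (hper i).nat_mul c
  have hall : ∀ l, y i (n + l) = y j (n' + l) := by
    intro l
    have h1 := (hmper i hi).nat_mul (l / m) (n + l % m)
    have h2 := (hmper j hj).nat_mul (l / m) (n' + l % m)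
    simp only [Nat.cast_id] at h1 h2
    rw [add_assoc, mul_comm, Nat.mod_add_div] at h1 h2
    rw [h1, h2]
    exact hcon _ (Nat.mod_lt _ hmpos)
  have hq : Function.Periodic (y i) (p j) := by
    intro l
    have e : ∃ c, l + c * m = n + (l + c * m - n) := by
      refine ⟨n, ?_⟩
      have : n ≤ n * m := Nat.le_mul_of_pos_right _ hmpos
      omega
    obtain ⟨c, hc⟩ := e
    have h1 := (hmper i hi).nat_mul c l
    have h2 := (hmper i hi).nat_mul c (l + p j)
    simp only [Nat.cast_id] at h1 h2
    rw [← h1, ← h2, add_right_comm, hc, add_assoc n, hall, hall, ← add_assoc, hper j]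
  exact hnc i ((hper i).one_of_coprime hq
    ((Nat.coprime_primes (hpp i) (hpp j)).mpr (hpi i j hij)) (hpp j).one_lt)

/-- The sum of `F` over the shifts of `q` by the times in `[a, b)`. -/
noncomputable def shiftSum {α : Type*} (F : (ℕ → α) → ℝ) (q : ℕ → α) (a b : ℕ) : ℝ :=
  ∑ n ∈ Finset.Ico a b, F (fun l => q (n + l))

theorem shiftSum_add {α : Type*} (F : (ℕ → α) → ℝ) (q : ℕ → α) {a b c : ℕ} (hab : a ≤ b)
    (hbc : b ≤ c) : shiftSum F q a b + shiftSum F q b c = shiftSum F q a c :=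
  Finset.sum_Ico_consecutive _ hab hbc

/-- `F` takes values in `[0, 1]` and depends only on the first `m` coordinates. -/
structure IsLocal {α : Type*} (m : ℕ) (F : (ℕ → α) → ℝ) : Prop where
  nonneg : ∀ x, 0 ≤ F x
  le_one : ∀ x, F x ≤ 1
  congr : ∀ x y, (∀ l < m, x l = y l) → F x = F y

theorem IsLocal.abs_sub_le_one {α : Type*} {m : ℕ} {F : (ℕ → α) → ℝ} (hF : IsLocal m F)
    (x y : ℕ → α) : |F x - F y| ≤ 1 := by
  rw [abs_le]
  constructor <;> linarith [hF.nonneg x, hF.nonneg y, hF.le_one x, hF.le_one y]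

/-- If only the terms in `[u, v)` can differ then the sums differ by at most `v - u`. -/
theorem IsLocal.abs_shiftSum_sub_le {α : Type*} {m : ℕ} {F : (ℕ → α) → ℝ} (hF : IsLocal m F)
    {p q : ℕ → α} {a b : ℕ} (u v : ℕ)
    (h : ∀ n, a ≤ n → n < b → ¬ (u ≤ n ∧ n < v) → ∀ l < m, p (n + l) = q (n + l)) :
    |shiftSum F p a b - shiftSum F q a b| ≤ ((v - u : ℕ) : ℝ) := by
  classical
  rw [shiftSum, shiftSum, ← Finset.sum_sub_distrib]
  calc |∑ n ∈ Finset.Ico a b, (F (fun l => p (n + l)) - F (fun l => q (n + l)))|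
      ≤ ∑ n ∈ Finset.Ico a b, |F (fun l => p (n + l)) - F (fun l => q (n + l))| :=
        Finset.abs_sum_le_sum_abs _ _
    _ ≤ ∑ n ∈ Finset.Ico a b, if n ∈ Finset.Ico u v then (1 : ℝ) else 0 := by
        refine Finset.sum_le_sum fun n hn => ?_
        rw [Finset.mem_Ico] at hn
        split_ifs with huv
        · exact hF.abs_sub_le_one _ _
        · rw [Finset.mem_Ico] at huv
          rw [hF.congr _ _ (h n hn.1 hn.2 huv), sub_self, abs_zero]
    _ = (((Finset.Ico a b).filter (· ∈ Finset.Ico u v)).card : ℝ) := by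
        rw [Finset.sum_boole]
    _ ≤ ((Finset.Ico u v).card : ℝ) := by
        exact_mod_cast Finset.card_le_card fun n hn => (Finset.mem_filter.mp hn).2
    _ = ((v - u : ℕ) : ℝ) := by rw [Nat.card_Ico]

theorem IsLocal.abs_shiftSum_sub_le_of_prefix {α : Type*} {m : ℕ} {F : (ℕ → α) → ℝ}
    (hF : IsLocal m F) {p q : ℕ → α} {b : ℕ} (h : ∀ n < b, p n = q n) :
    |shiftSum F p 0 b - shiftSum F q 0 b| ≤ m := by
  refine (hF.abs_shiftSum_sub_le (b - m) b ?_).trans ?_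
  · intro n _ hn hn' l hl
    exact h _ (by omega)
  · exact_mod_cast (by omega : b - (b - m) ≤ m)

open scoped Classical in
/-- The indicator of the sequences that agree with some shift of `y` on the first `m` symbols. -/
noncomputable def orbitIndicator {α : Type*} (m : ℕ) (y : ℕ → α) (x : ℕ → α) : ℝ :=
  if ∃ n, ∀ l < m, x l = y (n + l) then 1 else 0

theorem isLocal_orbitIndicator {α : Type*} (m : ℕ) (y : ℕ → α) :
    IsLocal m (orbitIndicator m y) where
  nonneg x := by unfold orbitIndicator; split_ifs <;> norm_num
  le_one x := by unfold orbitIndicator; split_ifs <;> norm_num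
  congr x x' h := by
    have : (∃ n, ∀ l < m, x l = y (n + l)) ↔ ∃ n, ∀ l < m, x' l = y (n + l) :=
      exists_congr fun n => forall₂_congr fun l hl => by rw [h l hl]
    classical exact if_congr this rfl rfl

theorem shiftSum_orbitIndicator_self {α : Type*} (m : ℕ) (y : ℕ → α) {a b : ℕ} (hab : a ≤ b) :
    shiftSum (orbitIndicator m y) y a b = (b : ℝ) - a := by
  have : ∀ n ∈ Finset.Ico a b, orbitIndicator m y (fun l => y (n + l)) = 1 :=
    fun n _ => if_pos ⟨n, fun _ _ => rfl⟩
  rw [shiftSum, Finset.sum_congr rfl this]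
  simp [Nat.cast_sub hab]

theorem shiftSum_orbitIndicator_of_disjoint {α : Type*} {m : ℕ} {y y' : ℕ → α}
    (h : ∀ n n', ∃ l < m, y (n + l) ≠ y' (n' + l)) (a b : ℕ) :
    shiftSum (orbitIndicator m y') y a b = 0 := by
  refine Finset.sum_eq_zero fun n _ => if_neg ?_
  rintro ⟨n', hn'⟩
  obtain ⟨l, hl, hne⟩ := h n n'
  exact hne (hn' l hl)

/-- Starting from `p` at time `n`, one may spend prescribed numbers of steps near each of
finitely many disjoint orbits. -/
theorem exists_visiting {κ : ℕ} {A : Matrix (Fin κ) (Fin κ) ℕ} {N : ℕ} (hN : 1 ≤ N)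
    (hc : ConnectsIn A N) {y : ℕ → ℕ → Fin κ} (hy : ∀ i, Admissible A (y i)) {d m : ℕ}
    (hm : ∀ i ≤ d, ∀ j ≤ d, i ≠ j → ∀ n n', ∃ l < m, y i (n + l) ≠ y j (n' + l))
    {p : ℕ → Fin κ} (hp : Admissible A p) (n : ℕ) (t : ℕ → ℕ) (J : ℕ) (hJ : J ≤ d + 1) :
    ∃ q, Admissible A q ∧ (∀ l ≤ n, q l = p l) ∧ ∀ i ≤ d,
      |shiftSum (orbitIndicator m (y i)) q 0 (n + ∑ j ∈ Finset.range J, t j) -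
        (shiftSum (orbitIndicator m (y i)) p 0 n + if i < J then (t i : ℝ) else 0)| ≤
      J * (N + m) := by
  induction J with
  | zero => exact ⟨p, hp, fun _ _ => rfl, fun i _ => by simp⟩
  | succ J ih =>
    obtain ⟨q, hq, hqp, hcount⟩ := ih (by omega)
    set s := n + ∑ j ∈ Finset.range J, t j with hs
    obtain ⟨z, hz, hzq, hzy⟩ := hq.exists_splice hN hc ((hy J).shift (s + N)) s
    refine ⟨z, hz, fun l hl => (hzq l (by omega)).trans (hqp l hl), fun i hi => ?_⟩
    rw [Finset.sum_range_succ, ← add_assoc, ← hs]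
    have hloc := isLocal_orbitIndicator m (y i)
    have e1 := hloc.abs_shiftSum_sub_le_of_prefix (p := z) (q := q) (b := s)
      fun l hl => hzq l hl.le
    have e2 : |shiftSum (orbitIndicator m (y i)) z s (s + t J) -
        shiftSum (orbitIndicator m (y i)) (y J) s (s + t J)| ≤ N := by
      have := hloc.abs_shiftSum_sub_le (p := z) (q := y J) (a := s) (b := s + t J) s (s + N) ?_
      · simpa using this
      · intro k hk hk' hns l _
        obtain ⟨r, hr⟩ := Nat.exists_eq_add_of_le (show s + N ≤ k + l by omega)
        rw [hr, hzy]
    have e3 : shiftSum (orbitIndicator m (y i)) (y J) s (s + t J) =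
        if i = J then (t J : ℝ) else 0 := by
      split_ifs with hiJ
      · rw [hiJ, shiftSum_orbitIndicator_self _ _ (by omega)]
        push_cast; ring
      · exact shiftSum_orbitIndicator_of_disjoint (hm J (by omega) i hi (Ne.symm hiJ)) _ _
    have e4 := hcount i hi
    have e5 := shiftSum_add (orbitIndicator m (y i)) z (Nat.zero_le s) (Nat.le_add_right s (t J))
    have e6 : (if i < J + 1 then (t i : ℝ) else 0) =
        (if i < J then (t i : ℝ) else 0) + if i = J then (t J : ℝ) else 0 := by
      rcases lt_trichotomy i J with h | h | h
      · simp [h, h.ne, h.trans (Nat.lt_succ_self J)]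
      · simp [h]
      · simp [h.ne', show ¬ i < J by omega, show ¬ i < J + 1 by omega]
    rw [e3] at e2
    rw [← e5, e6]
    push_cast
    rw [abs_le] at *
    constructor <;> linarith [e1.1, e1.2, e2.1, e2.2, e4.1, e4.2]

/-- After time `n`, a word of length `b` can be inserted before the path `x` so that the orbit
counts at time `n + b` are close to multiples of `w` in prescribed residue classes. -/
theorem exists_steering {κ : ℕ} {A : Matrix (Fin κ) (Fin κ) ℕ} {N : ℕ} (hN : 1 ≤ N)
    (hc : ConnectsIn A N) {y : ℕ → ℕ → Fin κ} (hy : ∀ i, Admissible A (y i)) {d m : ℕ}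
    (hm : ∀ i ≤ d, ∀ j ≤ d, i ≠ j → ∀ n n', ∃ l < m, y i (n + l) ≠ y j (n' + l))
    {p x : ℕ → Fin κ} (hp : Admissible A p) (hx : Admissible A x) (n : ℕ) {b : ℕ} (hb : N ≤ b)
    (Q : ℕ) (r : ℕ → ℕ) {w : ℝ} (hw : 0 < w) (hwb : d * ((Q + 1) * w) ≤ b) :
    ∃ q, Admissible A q ∧ (∀ l ≤ n, q l = p l) ∧ (∀ l, q (n + b + l) = x l) ∧
      ∀ i < d, ∃ u : ℤ, ((Q : ℤ) + 1) ∣ u - r i ∧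
        |shiftSum (orbitIndicator m (y i)) q 0 (n + b) - u * w| ≤ (d + 3) * (N + m) := by
  set P : ℕ → ℝ := fun i => shiftSum (orbitIndicator m (y i)) p 0 n
  have hQ : (0 : ℝ) < (Q : ℝ) + 1 := by positivity
  let u : ℕ → ℤ := fun i => r i + (Q + 1) * ⌈(P i / w - r i) / (Q + 1)⌉
  have hu : ∀ i, P i ≤ u i * w ∧ u i * w ≤ P i + (Q + 1) * w := by
    intro i
    have h1 := Int.le_ceil ((P i / w - r i) / (Q + 1))
    have h2 := (Int.ceil_lt_add_one ((P i / w - r i) / (Q + 1))).le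
    rw [div_le_iff₀ hQ, sub_le_iff_le_add, div_le_iff₀ hw] at h1
    rw [← sub_le_iff_le_add, le_div_iff₀ hQ, le_sub_iff_add_le, le_div_iff₀ hw] at h2
    simp only [u]
    push_cast
    constructor <;> linarith
  let t₀ : ℕ → ℕ := fun i => ⌊u i * w - P i⌋₊
  have ht₀ : ∀ i, |(t₀ i : ℝ) - (u i * w - P i)| ≤ 1 ∧ (t₀ i : ℝ) ≤ (Q + 1) * w := by
    intro i
    have h0 : 0 ≤ u i * w - P i := sub_nonneg.mpr (hu i).1
    have h1 := Nat.floor_le h0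
    have h2 := Nat.lt_floor_add_one (u i * w - P i)
    refine ⟨?_, ?_⟩
    · rw [abs_le]; constructor <;> simp only [t₀] <;> linarith
    · simp only [t₀]; linarith [(hu i).2]
  have hsum : ∑ j ∈ Finset.range d, t₀ j ≤ b := by
    have : ((∑ j ∈ Finset.range d, t₀ j : ℕ) : ℝ) ≤ b := by
      push_cast
      refine (Finset.sum_le_sum fun i _ => (ht₀ i).2).trans ?_
      simpa using hwb
    exact_mod_cast this
  let t : ℕ → ℕ := fun i => if i < d then t₀ i else b - ∑ j ∈ Finset.range d, t₀ j
  have ht : ∑ j ∈ Finset.range (d + 1), t j = b := by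
    rw [Finset.sum_range_succ]
    have : ∑ j ∈ Finset.range d, t j = ∑ j ∈ Finset.range d, t₀ j :=
      Finset.sum_congr rfl fun i hi => if_pos (Finset.mem_range.mp hi)
    rw [this]
    simp only [t, lt_irrefl, if_false]
    omega
  obtain ⟨q₀, hq₀, hq₀p, hcount⟩ := exists_visiting hN hc hy hm hp n t (d + 1) le_rfl
  obtain ⟨q, hq, hqq₀, hqx⟩ := hq₀.exists_splice hN hc hx (n + (b - N))
  rw [show n + (b - N) + N = n + b by omega] at hqx
  refine ⟨q, hq, fun l hl => (hqq₀ l (by omega)).trans (hq₀p l hl), hqx, fun i hi => ?_⟩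
  refine ⟨u i, ⟨⌈(P i / w - r i) / (Q + 1)⌉, by simp only [u]; ring⟩, ?_⟩
  have e1 := hcount i hi.le
  rw [ht, if_pos (by omega), show t i = t₀ i from if_pos hi] at e1
  have e2 : |shiftSum (orbitIndicator m (y i)) q 0 (n + b) -
      shiftSum (orbitIndicator m (y i)) q₀ 0 (n + b)| ≤ N + m := by
    have := (isLocal_orbitIndicator m (y i)).abs_shiftSum_sub_le (p := q) (q := q₀) (a := 0)
      (b := n + b) (n + b - (N + m)) (n + b)
      fun k _ hk hk' l hl => hqq₀ _ (by omega)
    refine this.trans ?_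
    exact_mod_cast (by omega : n + b - (n + b - (N + m)) ≤ N + m)
  have e3 := (ht₀ i).1
  have hN' : (1 : ℝ) ≤ N := by exact_mod_cast hN
  have hm' : (0 : ℝ) ≤ m := Nat.cast_nonneg m
  push_cast at e1
  rw [abs_le] at *
  simp only [P] at e3
  constructor <;> linarith [e1.1, e1.2, e2.1, e2.2, e3.1, e3.2]

theorem exists_seq_of_step {α : Type*} {I : ℕ → α → Prop} {R : ℕ → α → α → Prop} {a : α}
    (h0 : I 0 a) (hstep : ∀ k p, I k p → ∃ p', I (k + 1) p' ∧ R k p p') :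
    ∃ s : ℕ → α, ∀ k, I k (s k) ∧ R k (s k) (s (k + 1)) := by
  have : Nonempty α := ⟨a⟩
  choose! f hf using hstep
  let s : ℕ → α := fun k => Nat.rec a (fun k p => f k p) k
  have hs : ∀ k, I k (s k) := by
    intro k
    induction k with
    | zero => exact h0
    | succ k ih => exact (hf k _ ih).1
  exact ⟨s, fun k => ⟨hs k, (hf k _ (hs k)).2⟩⟩

/-- A sequence of paths that stabilize on longer and longer prefixes has a limit path. -/
theorem Admissible.exists_limit {κ : ℕ} {A : Matrix (Fin κ) (Fin κ) ℕ} {s : ℕ → ℕ → Fin κ}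
    (hs : ∀ k, Admissible A (s k)) {n : ℕ → ℕ} (hn : StrictMono n) (hn0 : 0 < n 0)
    (h : ∀ k, ∀ l < n k, s (k + 1) l = s k l) :
    ∃ z, Admissible A z ∧ ∀ k, ∀ l < n k, z l = s k l := by
  have hstab : ∀ k j, k ≤ j → ∀ l < n k, s j l = s k l := by
    intro k j hkj l hl
    induction j, hkj using Nat.le_induction with
    | base => rfl
    | succ j hj ih => rw [h j l (hl.trans_le (hn.monotone hj)), ih]
  have hid : ∀ l, l < n l := by
    intro l
    induction l with
    | zero => exact hn0
    | succ l ih => exact lt_of_le_of_lt ih (hn (Nat.lt_succ_self l))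
  have hz : ∀ k, ∀ l < n k, s l l = s k l := by
    intro k l hl
    rcases le_total k l with hkl | hkl
    · exact hstab k l hkl l hl
    · exact (hstab l k hkl l (hid l)).symm
  refine ⟨fun l => s l l, fun l => ?_, hz⟩
  have h1 := hz (l + 1) l ((Nat.lt_succ_self l).trans (hid _))
  show A (s l l) (s (l + 1) (l + 1)) = 1
  rw [h1]
  exact hs _ _

/-- The time at which the `k`-th insertion ends. -/
def stageTime (M N k : ℕ) : ℕ := (M + 1) * (N * (2 ^ (k + 1) - 1))

/-- Words can be inserted into every path `x` with density at most `1 / (M + 1)`, at places not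
depending on `x`, so that at the end of each insertion the orbit counts lie close to multiples
of a fixed fraction of the time, in residue classes prescribed by the schedule `dd`, `QQ`, `rr`. -/
theorem exists_insertion {κ : ℕ} {A : Matrix (Fin κ) (Fin κ) ℕ} {N : ℕ} (hN : 1 ≤ N)
    (hc : ConnectsIn A N) {y : ℕ → ℕ → Fin κ} (hy : ∀ i, Admissible A (y i)) {m : ℕ → ℕ}
    (hm : ∀ d, ∀ i ≤ d, ∀ j ≤ d, i ≠ j → ∀ n n', ∃ l < m d, y i (n + l) ≠ y j (n' + l))
    {M : ℕ} (hM : 1 ≤ M) (dd QQ : ℕ → ℕ) (rr : ℕ → ℕ → ℕ) :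
    ∃ pos : ℕ → ℕ, (∀ j, M * pos j ≤ (M + 1) * j) ∧
      ∀ x, Admissible A x → ∃ z, Admissible A z ∧ (∀ j, z (pos j) = x j) ∧
        ∀ k, ∀ i < dd k, ∃ u : ℤ, ((QQ k : ℤ) + 1) ∣ u - rr k i ∧
          |shiftSum (orbitIndicator (m (dd k)) (y i)) z 0 (stageTime M N k) -
            u * (stageTime M N k / (2 * (M + 1) * (dd k + 1) * (QQ k + 1)))| ≤
          (dd k + 4) * (N + m (dd k)) := by
  let c : ℕ → ℕ := fun k => M * (N * (2 ^ k - 1))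
  let τ : ℕ → ℕ := fun k => (M + 1) * (N * (2 ^ k - 1))
  have hpow : ∀ k, 2 ^ (k + 1) - 1 = (2 ^ k - 1) + 2 ^ k := by
    intro k
    have : 1 ≤ 2 ^ k := Nat.one_le_two_pow
    rw [pow_succ]; omega
  have hcs : ∀ k, c (k + 1) = c k + M * (N * 2 ^ k) := by
    intro k; simp only [c, hpow]; ring
  have hτs : ∀ k, τ (k + 1) = τ k + M * (N * 2 ^ k) + N * 2 ^ k := by
    intro k; simp only [τ, hpow]; ring
  have hτc : ∀ k, τ k = c k + N * (2 ^ k - 1) := by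
    intro k; simp only [c, τ]; ring
  let ind : ℕ → ℕ := fun j => Nat.log 2 (j / (M * N) + 1)
  have hMN : 0 < M * N := Nat.mul_pos hM hN
  have hind : ∀ j, c (ind j) ≤ j ∧ j < c (ind j + 1) := by
    intro j
    have h1 : 2 ^ ind j ≤ j / (M * N) + 1 := Nat.pow_log_le_self 2 (Nat.succ_ne_zero _)
    have h2 : j / (M * N) + 1 < 2 ^ (ind j + 1) := Nat.lt_pow_succ_log_self (by norm_num) _
    constructor
    · calc c (ind j) = (2 ^ ind j - 1) * (M * N) := by simp only [c]; ring
        _ ≤ j / (M * N) * (M * N) := Nat.mul_le_mul_right _ (by omega)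
        _ ≤ j := Nat.div_mul_le_self _ _
    · calc j < (2 ^ (ind j + 1) - 1) * (M * N) := by
            rw [← Nat.div_lt_iff_lt_mul hMN]; omega
        _ = c (ind j + 1) := by simp only [c]; ring
  refine ⟨fun j => j + N * (2 ^ ind j - 1), fun j => ?_, fun x hx => ?_⟩
  · have := (hind j).1
    simp only [c] at this
    nlinarith
  obtain ⟨s, hs⟩ := exists_seq_of_step
    (I := fun k p => Admissible A p ∧ ∀ l, p (τ k + l) = x (c k + l))
    (R := fun k p p' => (∀ l < τ k + M * (N * 2 ^ k), p' l = p l) ∧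
      ∀ i < dd k, ∃ u : ℤ, ((QQ k : ℤ) + 1) ∣ u - rr k i ∧
        |shiftSum (orbitIndicator (m (dd k)) (y i)) p' 0 (τ (k + 1)) -
          u * (stageTime M N k / (2 * (M + 1) * (dd k + 1) * (QQ k + 1)))| ≤
          (dd k + 3) * (N + m (dd k)))
    (a := x) ⟨hx, fun l => by simp [c, τ]⟩ (by
      rintro k p ⟨hp, hpx⟩
      have h2 : 1 ≤ 2 ^ k := Nat.one_le_two_pow
      have hT : (stageTime M N k : ℝ) ≤ 2 * (M + 1) * ((N * 2 ^ k : ℕ) : ℝ) := by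
        have : stageTime M N k ≤ 2 * (M + 1) * (N * 2 ^ k) := by
          calc stageTime M N k ≤ (M + 1) * (N * 2 ^ (k + 1)) :=
                Nat.mul_le_mul_left _ (Nat.mul_le_mul_left _ (Nat.sub_le _ _))
            _ = 2 * (M + 1) * (N * 2 ^ k) := by ring
        exact_mod_cast this
      have hT0 : (0 : ℝ) < stageTime M N k := by
        have h3 : 0 < 2 ^ (k + 1) - 1 := by rw [hpow]; omega
        have : 0 < stageTime M N k := Nat.mul_pos (by omega) (Nat.mul_pos hN h3)
        exact_mod_cast this
      obtain ⟨q, hq, hqp, hqx, hqu⟩ := exists_steering hN hc hy (hm (dd k)) hp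
        (hx.shift (c (k + 1))) (τ k + M * (N * 2 ^ k)) (b := N * 2 ^ k)
        (Nat.le_mul_of_pos_right _ h2) (QQ k) (rr k)
        (w := stageTime M N k / (2 * (M + 1) * (dd k + 1) * (QQ k + 1))) (by positivity) (by
          have e : (dd k : ℝ) * ((QQ k + 1) *
              (stageTime M N k / (2 * (M + 1) * (dd k + 1) * (QQ k + 1)))) =
              (dd k / (dd k + 1)) * (stageTime M N k / (2 * (M + 1))) := by
            field_simp
          rw [e]
          have e1 : (dd k : ℝ) / (dd k + 1) ≤ 1 := by
            rw [div_le_one (by positivity)]; linarith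
          have e2 : (stageTime M N k : ℝ) / (2 * (M + 1)) ≤ ((N * 2 ^ k : ℕ) : ℝ) := by
            rw [div_le_iff₀ (by positivity)]; linarith
          calc _ ≤ 1 * ((stageTime M N k : ℝ) / (2 * (M + 1))) := by gcongr
            _ ≤ _ := by rw [one_mul]; exact e2)
      rw [← hτs] at hqx hqu
      exact ⟨q, ⟨hq, hqx⟩, fun l hl => hqp l hl.le, hqu⟩)
  have hmono : StrictMono fun k => τ k + M * (N * 2 ^ k) := by
    refine strictMono_nat_of_lt_succ fun k => ?_
    have : 0 < M * (N * 2 ^ (k + 1)) := by positivity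
    simp only [hτs]
    omega
  obtain ⟨z, hz, hzs⟩ := Admissible.exists_limit (fun k => (hs k).1.1) hmono
    (by simp only [τ]; simp; omega) (fun k => (hs k).2.1)
  refine ⟨z, hz, fun j => ?_, fun k i hi => ?_⟩
  · obtain ⟨h1, h2⟩ := hind j
    rw [hcs] at h2
    obtain ⟨l, hl⟩ := Nat.exists_eq_add_of_le h1
    have e : j + N * (2 ^ ind j - 1) = τ (ind j) + l := by rw [hτc]; omega
    show z (j + N * (2 ^ ind j - 1)) = x j
    rw [e, hzs (ind j) _ (by omega), (hs (ind j)).1.2, ← hl]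
  · obtain ⟨u, hu, hle⟩ := (hs k).2.2 i hi
    refine ⟨u, hu, ?_⟩
    have e := (isLocal_orbitIndicator (m (dd k)) (y i)).abs_shiftSum_sub_le_of_prefix
      (p := z) (q := s (k + 1)) (b := τ (k + 1)) fun l hl => hzs (k + 1) l (by omega)
    change |shiftSum (orbitIndicator (m (dd k)) (y i)) z 0 (τ (k + 1)) - _| ≤ _
    have hN' : (0 : ℝ) ≤ N := Nat.cast_nonneg N
    rw [abs_le] at *
    constructor <;> linarith [e.1, e.2, hle.1, hle.2]

theorem bddBelow_couplingCosts {M : Type*} [MetricSpace M] [MeasurableSpace M]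
    (μ ν : Measure M) : BddBelow { r : ℝ | ∃ P : Measure (M × M), IsProbabilityMeasure P ∧
    P.map Prod.fst = μ ∧ P.map Prod.snd = ν ∧ r = ∫ p, dist p.1 p.2 ∂P } := by
  refine ⟨0, ?_⟩
  rintro r ⟨P, -, -, -, rfl⟩
  exact integral_nonneg fun p => dist_nonneg

theorem nonempty_couplingCosts {M : Type*} [MetricSpace M] [MeasurableSpace M]
    (μ ν : Measure M) [IsProbabilityMeasure μ] [IsProbabilityMeasure ν] :
    { r : ℝ | ∃ P : Measure (M × M), IsProbabilityMeasure P ∧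
    P.map Prod.fst = μ ∧ P.map Prod.snd = ν ∧ r = ∫ p, dist p.1 p.2 ∂P }.Nonempty :=
  ⟨_, μ.prod ν, inferInstance, by simp, by simp, rfl⟩

theorem wassersteinDist_nonneg {M : Type*} [MetricSpace M] [MeasurableSpace M]
    (μ ν : Measure M) : 0 ≤ wassersteinDist μ ν := by
  refine Real.sInf_nonneg ?_
  rintro r ⟨P, -, -, -, rfl⟩
  exact integral_nonneg fun p => dist_nonneg

theorem wassersteinDist_le_one {M : Type*} [MetricSpace M] [MeasurableSpace M]
    (hM : ∀ x y : M, dist x y ≤ 1) (μ ν : Measure M) [IsProbabilityMeasure μ]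
    [IsProbabilityMeasure ν] : wassersteinDist μ ν ≤ 1 := by
  obtain ⟨r, hr⟩ := nonempty_couplingCosts μ ν
  refine (csInf_le (bddBelow_couplingCosts μ ν) hr).trans ?_
  obtain ⟨P, hP, -, -, rfl⟩ := hr
  refine (integral_mono_of_nonneg (ae_of_all _ fun p : M × M => dist_nonneg)
    (integrable_const 1) (ae_of_all _ fun p : M × M => hM p.1 p.2)).trans ?_
  simp

theorem abs_integral_sub_le_wassersteinDist {M : Type*} [MetricSpace M] [MeasurableSpace M]
    [OpensMeasurableSpace M] [SecondCountableTopology M] (hM : ∀ x y : M, dist x y ≤ 1)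
    (μ ν : Measure M) [IsProbabilityMeasure μ] [IsProbabilityMeasure ν] {f : M → ℝ} {K : ℝ}
    (hK : 0 < K) (hf : Measurable f) (hf0 : ∀ x, 0 ≤ f x) (hf1 : ∀ x, f x ≤ 1)
    (hlip : ∀ x y, |f x - f y| ≤ K * dist x y) :
    |∫ x, f x ∂μ - ∫ x, f x ∂ν| ≤ K * wassersteinDist μ ν := by
  rw [← div_le_iff₀' hK]
  refine le_csInf (nonempty_couplingCosts μ ν) ?_
  rintro r ⟨P, hP, rfl, rfl, rfl⟩
  rw [div_le_iff₀' hK]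
  have hint : ∀ {g : M × M → ℝ}, Measurable g → (∀ p, 0 ≤ g p) → (∀ p, g p ≤ 1) →
      Integrable g P := fun hg h0 h1 =>
    Integrable.of_bound hg.aestronglyMeasurable 1
      (ae_of_all _ fun p => by rw [Real.norm_of_nonneg (h0 p)]; exact h1 p)
  rw [integral_map measurable_fst.aemeasurable hf.aestronglyMeasurable,
    integral_map measurable_snd.aemeasurable hf.aestronglyMeasurable,
    ← integral_sub (f := fun p : M × M => f p.1) (g := fun p : M × M => f p.2)
      (hint (hf.comp measurable_fst) (fun p => hf0 _) fun p => hf1 _)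
      (hint (hf.comp measurable_snd) (fun p => hf0 _) fun p => hf1 _), ← integral_const_mul]
  refine abs_integral_le_integral_abs.trans (integral_mono_of_nonneg
    (ae_of_all _ fun p => abs_nonneg _) ?_ (ae_of_all _ fun p => hlip p.1 p.2))
  exact (hint (measurable_fst.dist measurable_snd) (fun p => dist_nonneg)
    fun p => hM _ _).const_mul K

theorem isProbabilityMeasure_empiricalMeasure {M : Type*} [MetricSpace M] [MeasurableSpace M]
    (f : M → M) (x : M) {n : ℕ} (hn : n ≠ 0) : IsProbabilityMeasure (empiricalMeasure f x n) := by
  constructor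
  simp [empiricalMeasure, ENNReal.inv_mul_cancel, hn]

theorem integral_empiricalMeasure {M : Type*} [MetricSpace M] [MeasurableSpace M]
    [MeasurableSingletonClass M] (f : M → M) (x : M) (n : ℕ) (g : M → ℝ) :
    ∫ y, g y ∂(empiricalMeasure f x n) = (∑ k ∈ Finset.range n, g (f^[k] x)) / n := by
  rw [empiricalMeasure, integral_smul_measure,
    integral_finsetSum_measure fun k _ => integrable_dirac (by simp)]
  simp [div_eq_inv_mul]

/-- An average of `n` point masses is close to a measure with masses in `(1/K)ℤ` on a finite set
of representatives. -/
theorem exists_wassersteinDist_average_le {M W : Type*} [MetricSpace M] [MeasurableSpace M]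
    [OpensMeasurableSpace M] [SecondCountableTopology M] [Fintype W] [DecidableEq W]
    (hM : ∀ x y : M, dist x y ≤ 1) {η : ℝ} (word : M → W) (rep : W → M)
    (hrep : ∀ y, dist y (rep (word y)) ≤ η) (x₀ : M) {K : ℕ} (hK : 0 < K) {n : ℕ} (hn : 0 < n)
    (y : ℕ → M) : ∃ α : W → Fin (K + 1), (∑ w, (α w : ℕ)) ≤ K ∧
      wassersteinDist ((n : ENNReal)⁻¹ • ∑ k ∈ Finset.range n, Measure.dirac (y k))
        ((∑ w, ENNReal.ofReal ((α w : ℕ) / K) • Measure.dirac (rep w)) +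
          ENNReal.ofReal (1 - ∑ w, ((α w : ℕ) : ℝ) / K) • Measure.dirac x₀) ≤
        η + Fintype.card W / K := by
  have hK' : (0 : ℝ) < K := by exact_mod_cast hK
  have hn' : (0 : ℝ) < n := by exact_mod_cast hn
  let c : W → ℕ := fun w => ((Finset.range n).filter fun k => word (y k) = w).card
  have hcsum : ∑ w, c w = n := by
    have := Finset.card_eq_sum_card_fiberwise (s := Finset.range n) (t := Finset.univ)
      (f := fun k => word (y k)) (fun k _ => Finset.mem_coe.mpr (Finset.mem_univ _))
    rw [Finset.card_range] at this
    exact this.symm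
  have hcle : ∀ w, c w ≤ n := fun w => (Finset.card_filter_le _ _).trans (by simp)
  let α : W → ℕ := fun w => K * c w / n
  have hα1 : ∀ w, (α w : ℝ) / K ≤ c w / n := by
    intro w
    rw [div_le_div_iff₀ hK' hn']
    have : α w * n ≤ K * c w := Nat.div_mul_le_self _ _
    calc (α w : ℝ) * n ≤ K * c w := by exact_mod_cast this
      _ = c w * K := mul_comm _ _
  have hα2 : ∀ w, (c w : ℝ) / n ≤ α w / K + 1 / K := by
    intro w
    rw [← add_div, div_le_div_iff₀ hn' hK']
    have : K * c w < n * (α w + 1) := by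
      have := Nat.lt_mul_div_succ (K * c w) hn
      exact this
    calc (c w : ℝ) * K = K * c w := mul_comm _ _
      _ ≤ n * (α w + 1) := by exact_mod_cast this.le
      _ = _ := mul_comm _ _
  have hcsum' : ∑ w, (c w : ℝ) / n = 1 := by
    rw [← Finset.sum_div, div_eq_one_iff_eq hn'.ne']
    exact_mod_cast hcsum
  have hαsum : ∑ w, (α w : ℝ) / K ≤ 1 := hcsum' ▸ Finset.sum_le_sum fun w _ => hα1 w
  have hαsum2 : 1 - ∑ w, (α w : ℝ) / K ≤ Fintype.card W / K := by
    have : 1 ≤ ∑ w : W, ((α w : ℝ) / K + 1 / K) :=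
      hcsum'.symm.trans_le (Finset.sum_le_sum fun w _ => hα2 w)
    rw [Finset.sum_add_distrib] at this
    simp only [Finset.sum_const, Finset.card_univ, nsmul_eq_mul, mul_one_div] at this
    linarith
  have hαK : ∀ w, α w < K + 1 := by
    intro w
    refine Nat.lt_succ_of_le ?_
    calc α w ≤ K * n / n := Nat.div_le_div_right (Nat.mul_le_mul_left _ (hcle w))
      _ = K := Nat.mul_div_cancel _ hn
  refine ⟨fun w => ⟨α w, hαK w⟩, ?_, ?_⟩
  · have : ((∑ w, α w : ℕ) : ℝ) ≤ K := by
      rw [← Finset.sum_div, div_le_one hK'] at hαsum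
      exact_mod_cast hαsum
    exact_mod_cast this
  -- the masses transported to the representative and to the base point
  let a : ℕ → ℝ := fun k => (α (word (y k)) : ℝ) / K / c (word (y k))
  let b : ℕ → ℝ := fun k => 1 / n - a k
  have ha : ∀ k, 0 ≤ a k := fun k => by positivity
  have hcpos : ∀ k ∈ Finset.range n, 0 < c (word (y k)) := fun k hk =>
    Finset.card_pos.mpr ⟨k, Finset.mem_filter.mpr ⟨hk, rfl⟩⟩
  have hb : ∀ k ∈ Finset.range n, 0 ≤ b k := by
    intro k hk
    have hc : (0 : ℝ) < c (word (y k)) := by exact_mod_cast hcpos k hk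
    have := hα1 (word (y k))
    simp only [b, a, sub_nonneg]
    rw [div_le_iff₀ hc, one_div_mul_eq_div]
    exact this
  have hafib : ∀ w, ∑ k ∈ (Finset.range n).filter (fun k => word (y k) = w), a k = α w / K := by
    intro w
    have h1 : ∀ k ∈ (Finset.range n).filter (fun k => word (y k) = w),
        a k = (α w : ℝ) / K / c w := by
      intro k hk
      simp only [a, (Finset.mem_filter.mp hk).2]
    rw [Finset.sum_congr rfl h1, Finset.sum_const, nsmul_eq_mul]
    change (c w : ℝ) * _ = _
    rcases Nat.eq_zero_or_pos (c w) with h | h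
    · simp [α, h]
    · have : (c w : ℝ) ≠ 0 := by exact_mod_cast h.ne'
      field_simp
  have hasum : ∑ k ∈ Finset.range n, a k = ∑ w, (α w : ℝ) / K := by
    rw [← Finset.sum_fiberwise (Finset.range n) (fun k => word (y k)) a]
    exact Finset.sum_congr rfl fun w _ => hafib w
  have hbsum : ∑ k ∈ Finset.range n, b k = 1 - ∑ w, (α w : ℝ) / K := by
    simp only [b, Finset.sum_sub_distrib, hasum, Finset.sum_const, Finset.card_range, nsmul_eq_mul]
    rw [mul_one_div_cancel hn'.ne']
  let P : Measure (M × M) := ∑ k ∈ Finset.range n,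
    (ENNReal.ofReal (a k) • Measure.dirac (y k, rep (word (y k))) +
      ENNReal.ofReal (b k) • Measure.dirac (y k, x₀))
  have hfst : P.map Prod.fst =
      (n : ENNReal)⁻¹ • ∑ k ∈ Finset.range n, Measure.dirac (y k) := by
    simp only [P]
    rw [Measure.map_finset_sum measurable_fst.aemeasurable, Finset.smul_sum]
    refine Finset.sum_congr rfl fun k hk => ?_
    rw [Measure.map_add _ _ measurable_fst, Measure.map_smul, Measure.map_smul,
      Measure.map_dirac' measurable_fst, Measure.map_dirac' measurable_fst, ← add_smul,
      ← ENNReal.ofReal_add (ha k) (hb k hk)]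
    simp only [b, add_sub_cancel]
    rw [one_div, ENNReal.ofReal_inv_of_pos hn', ENNReal.ofReal_natCast]
  have hsnd : P.map Prod.snd = (∑ w, ENNReal.ofReal (α w / K) • Measure.dirac (rep w)) +
          ENNReal.ofReal (1 - ∑ w, (α w : ℝ) / K) • Measure.dirac x₀ := by
    have : P.map Prod.snd = ∑ k ∈ Finset.range n,
        (ENNReal.ofReal (a k) • Measure.dirac (rep (word (y k))) +
          ENNReal.ofReal (b k) • Measure.dirac x₀) := by
      simp only [P]
      rw [Measure.map_finset_sum measurable_snd.aemeasurable]
      refine Finset.sum_congr rfl fun k hk => ?_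
      rw [Measure.map_add _ _ measurable_snd, Measure.map_smul, Measure.map_smul,
        Measure.map_dirac' measurable_snd, Measure.map_dirac' measurable_snd]
    rw [this, Finset.sum_add_distrib, ← Finset.sum_smul, ← ENNReal.ofReal_sum_of_nonneg hb, hbsum,
      ← Finset.sum_fiberwise (Finset.range n) (fun k => word (y k))]
    congr 1
    refine Finset.sum_congr rfl fun w _ => ?_
    rw [← hafib w, ENNReal.ofReal_sum_of_nonneg fun k _ => ha k, Finset.sum_smul]
    exact Finset.sum_congr rfl fun k hk => by rw [(Finset.mem_filter.mp hk).2]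
  have hP : IsProbabilityMeasure P := by
    have : IsProbabilityMeasure (P.map Prod.fst) := by
      rw [hfst]
      constructor
      simp [ENNReal.inv_mul_cancel, hn.ne']
    exact (Measure.isProbabilityMeasure_map_iff measurable_fst.aemeasurable).mp this
  refine (csInf_le (bddBelow_couplingCosts _ _) ⟨P, hP, hfst, hsnd, rfl⟩).trans ?_
  have hint : ∀ (r : ℝ) (q : M × M), Integrable (fun p : M × M => dist p.1 p.2)
      (ENNReal.ofReal r • Measure.dirac q) := fun r q =>
    (integrable_dirac (by simp)).smul_measure ENNReal.ofReal_ne_top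
  simp only [P]
  rw [integral_finsetSum_measure fun k _ => (hint _ _).add_measure (hint _ _)]
  have hterm : ∀ k ∈ Finset.range n, ∫ p : M × M, dist p.1 p.2
      ∂(ENNReal.ofReal (a k) • Measure.dirac (y k, rep (word (y k))) +
      ENNReal.ofReal (b k) • Measure.dirac (y k, x₀)) ≤ (1 / n) * η + b k := by
    intro k hk
    rw [integral_add_measure (hint _ _) (hint _ _), integral_smul_measure, integral_smul_measure,
      integral_dirac, integral_dirac, ENNReal.toReal_ofReal (ha k),
      ENNReal.toReal_ofReal (hb k hk), smul_eq_mul, smul_eq_mul]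
    have hη : 0 ≤ η := dist_nonneg.trans (hrep x₀)
    have h1 : a k ≤ 1 / n := sub_nonneg.mp (hb k hk)
    exact add_le_add (mul_le_mul h1 (hrep _) dist_nonneg (by positivity))
      (mul_le_of_le_one_right (hb k hk) (hM _ _))
  refine (Finset.sum_le_sum hterm).trans ?_
  rw [Finset.sum_add_distrib, hbsum, Finset.sum_const, Finset.card_range, nsmul_eq_mul,
    ← mul_assoc, mul_one_div_cancel hn'.ne', one_mul]
  linarith

/-- The set defining the pointwise emergence is nonempty. -/
theorem exists_emergence_bound {M : Type*} [MetricSpace M] [MeasurableSpace M]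
    [OpensMeasurableSpace M] [SecondCountableTopology M] (hM : ∀ x y : M, dist x y ≤ 1)
    (hfin : ∀ η > 0, ∃ (L : ℕ) (word : M → Fin L) (rep : Fin L → M),
      ∀ y, dist y (rep (word y)) ≤ η)
    (f : M → M) (x : M) {ε : ℝ} (hε : 0 < ε) :
    { N : ℕ | 0 < N ∧ ∃ μs : Fin N → Measure M, (∀ j, IsProbabilityMeasure (μs j)) ∧
      Filter.limsup (fun n : ℕ => ⨅ j, wassersteinDist (empiricalMeasure f x n) (μs j))
        Filter.atTop ≤ ε }.Nonempty := by
  obtain ⟨L, word, rep, hrep⟩ := hfin (ε / 2) (half_pos hε)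
  obtain ⟨K, hK⟩ := exists_nat_gt (max 0 (L / (ε / 2)))
  have hK0 : (0 : ℝ) < K := (le_max_left _ _).trans_lt hK
  have hKL : (L : ℝ) / K ≤ ε / 2 := by
    have := ((le_max_right _ _).trans_lt hK).le
    rw [div_le_iff₀ (half_pos hε)] at this
    rw [div_le_iff₀ hK0]
    linarith
  let ν : (Fin L → Fin (K + 1)) → Measure M := fun α => if (∑ w, (α w : ℕ)) ≤ K then
    (∑ w, ENNReal.ofReal ((α w : ℕ) / K) • Measure.dirac (rep w)) +
      ENNReal.ofReal (1 - ∑ w, ((α w : ℕ) : ℝ) / K) • Measure.dirac x else Measure.dirac x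
  have hν : ∀ α, IsProbabilityMeasure (ν α) := by
    intro α
    simp only [ν]
    split_ifs with h
    · constructor
      have h0 : ∀ w ∈ Finset.univ, 0 ≤ ((α w : ℕ) : ℝ) / K := fun w _ => by positivity
      have h1 : ∑ w, ((α w : ℕ) : ℝ) / K ≤ 1 := by
        rw [← Finset.sum_div, div_le_one hK0]
        exact_mod_cast h
      simp only [Measure.coe_add, Pi.add_apply, Measure.coe_finsetSum, Finset.sum_apply,
        Measure.smul_apply, measure_univ, smul_eq_mul, mul_one]
      rw [← ENNReal.ofReal_sum_of_nonneg h0, ← ENNReal.ofReal_add (Finset.sum_nonneg h0)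
        (sub_nonneg.mpr h1), add_sub_cancel, ENNReal.ofReal_one]
    · infer_instance
  let e := Fintype.equivFin (Fin L → Fin (K + 1))
  refine ⟨Fintype.card (Fin L → Fin (K + 1)), Fintype.card_pos, fun j => ν (e.symm j),
    fun j => hν _, ?_⟩
  refine limsup_le_of_le ?_ ?_
  · exact isCoboundedUnder_le_of_le atTop (x := 0)
      fun n => Real.iInf_nonneg fun j => wassersteinDist_nonneg _ _
  · filter_upwards [eventually_gt_atTop 0] with n hn
    obtain ⟨α, hα, hle⟩ := exists_wassersteinDist_average_le hM word rep hrep x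
      (by exact_mod_cast hK0 : 0 < K) hn (fun k => f^[k] x)
    refine (ciInf_le (Finite.bddBelow_range _) (e α)).trans ?_
    rw [e.symm_apply_apply]
    simp only [ν, if_pos hα]
    refine hle.trans ?_
    rw [Fintype.card_fin]
    linarith

/-- The subshift of finite type with transition matrix `A`. -/
abbrev Subshift {κ : ℕ} (A : Matrix (Fin κ) (Fin κ) ℕ) : Type :=
  {x : ℕ → Fin κ // ∀ n, A (x n) (x (n + 1)) = 1}

theorem Subshift.dist_le_one {κ : ℕ} {A : Matrix (Fin κ) (Fin κ) ℕ} (x y : Subshift A) :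
    dist x y ≤ 1 :=
  PiNat.dist_le_one x.1 y.1

theorem Subshift.dist_le_iff {κ : ℕ} {A : Matrix (Fin κ) (Fin κ) ℕ} {x y : Subshift A} {m : ℕ} :
    dist x y ≤ (1 / 2) ^ m ↔ ∀ l < m, x.1 l = y.1 l :=
  (PiNat.mem_cylinder_iff_dist_le (x := y.1) (y := x.1)).symm

theorem Subshift.iterate_apply {κ : ℕ} {A : Matrix (Fin κ) (Fin κ) ℕ}
    {σ : Subshift A → Subshift A} (hσ : ∀ x, (σ x).1 = fun n => x.1 (n + 1)) (x : Subshift A)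
    (k : ℕ) : (σ^[k] x).1 = fun l => x.1 (k + l) := by
  induction k with
  | zero => simp
  | succ k ih =>
    rw [Function.iterate_succ_apply', hσ, ih]
    funext l
    rw [Nat.add_right_comm, Nat.add_assoc]

theorem IsLocal.abs_sub_le_dist {κ : ℕ} {A : Matrix (Fin κ) (Fin κ) ℕ} {m : ℕ}
    {F : (ℕ → Fin κ) → ℝ} (hF : IsLocal m F) (x y : Subshift A) :
    |F x.1 - F y.1| ≤ 2 ^ m * dist x y := by
  rcases le_or_gt (dist x y) ((1 / 2) ^ m) with h | h
  · rw [hF.congr _ _ (Subshift.dist_le_iff.mp h), sub_self, abs_zero]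
    positivity
  · refine (hF.abs_sub_le_one _ _).trans ?_
    calc (1 : ℝ) = 2 ^ m * (1 / 2) ^ m := by rw [← mul_pow]; norm_num
      _ ≤ _ := by gcongr

theorem IsLocal.measurable_subshift {κ : ℕ} {A : Matrix (Fin κ) (Fin κ) ℕ} {m : ℕ}
    {F : (ℕ → Fin κ) → ℝ} (hF : IsLocal m F) : Measurable fun x : Subshift A => F x.1 := by
  have : LipschitzWith (2 ^ m) fun x : Subshift A => F x.1 :=
    LipschitzWith.of_dist_le_mul fun x y => by
      rw [Real.dist_eq]
      push_cast
      exact hF.abs_sub_le_dist x y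
  exact this.continuous.measurable

theorem Subshift.exists_finite_net {κ : ℕ} {A : Matrix (Fin κ) (Fin κ) ℕ} (x₀ : Subshift A)
    (η : ℝ) (hη : 0 < η) : ∃ (L : ℕ) (word : Subshift A → Fin L) (rep : Fin L → Subshift A),
      ∀ y, dist y (rep (word y)) ≤ η := by
  obtain ⟨m, hm⟩ := exists_pow_lt_of_lt_one hη (one_half_lt_one (α := ℝ))
  let e := Fintype.equivFin (Fin m → Fin κ)
  let word : Subshift A → Fin (Fintype.card (Fin m → Fin κ)) := fun x => e fun l => x.1 l
  have : Nonempty (Subshift A) := ⟨x₀⟩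
  refine ⟨_, word, Function.invFun word, fun y => ?_⟩
  refine le_trans (Subshift.dist_le_iff.mpr fun l hl => ?_) hm.le
  have h : word (Function.invFun word (word y)) = word y := Function.invFun_eq ⟨y, rfl⟩
  exact (congrFun (e.injective h) ⟨l, hl⟩).symm

theorem integral_empiricalMeasure_subshift {κ : ℕ} {A : Matrix (Fin κ) (Fin κ) ℕ}
    {σ : Subshift A → Subshift A} (hσ : ∀ x, (σ x).1 = fun n => x.1 (n + 1))
    (F : (ℕ → Fin κ) → ℝ) (z : Subshift A) (n : ℕ) :
    ∫ x, F x.1 ∂(empiricalMeasure σ z n) = shiftSum F z.1 0 n / n := by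
  rw [integral_empiricalMeasure σ z n fun x => F x.1, shiftSum, Finset.range_eq_Ico]
  simp only [Subshift.iterate_apply hσ]

theorem le_stageTime {M N : ℕ} (hN : 1 ≤ N) (k : ℕ) : k + 1 ≤ stageTime M N k := by
  have h1 : k + 1 < 2 ^ (k + 1) := Nat.lt_two_pow_self
  calc k + 1 ≤ 2 ^ (k + 1) - 1 := by omega
    _ ≤ N * (2 ^ (k + 1) - 1) := Nat.le_mul_of_pos_left _ hN
    _ ≤ stageTime M N k := Nat.le_mul_of_pos_left _ (Nat.succ_pos M)

/-- If the averages of local functions at suitable arbitrarily large times realize all residue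
classes modulo `Q + 1` then the emergence is at least `(Q + 1) ^ d`. -/
theorem pow_le_pointwiseEmergence {κ : ℕ} {A : Matrix (Fin κ) (Fin κ) ℕ}
    {σ : Subshift A → Subshift A} (hσ : ∀ x, (σ x).1 = fun n => x.1 (n + 1)) (z : Subshift A)
    {d m Q : ℕ} {F : ℕ → (ℕ → Fin κ) → ℝ} (hF : ∀ i, IsLocal m (F i)) {w C ε : ℝ} (hw : 0 < w)
    (hε : 0 < ε) (hεw : 2 ^ m * (4 * ε) ≤ w / 2)
    (h : ∀ (r : Fin d → Fin (Q + 1)) (n₀ : ℕ), ∃ T ≥ n₀, ∀ i : Fin d, ∃ u : ℤ,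
      ((Q : ℤ) + 1) ∣ u - (r i : ℕ) ∧ |shiftSum (F i) z.1 0 T - u * (T * w)| ≤ C) :
    (Q + 1) ^ d ≤ pointwiseEmergence σ z ε := by
  obtain ⟨E, hE, hE0, μs, hμ, hlim⟩ : ∃ E, E = pointwiseEmergence σ z ε ∧ 0 < E ∧
      ∃ μs : Fin E → Measure (Subshift A), (∀ j, IsProbabilityMeasure (μs j)) ∧
        limsup (fun n : ℕ => ⨅ j, wassersteinDist (empiricalMeasure σ z n) (μs j)) atTop ≤ ε :=
    ⟨_, rfl, Nat.sInf_mem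
      (exists_emergence_bound Subshift.dist_le_one (Subshift.exists_finite_net z) σ z hε)⟩
  rw [← hE]
  have hne : Nonempty (Fin E) := ⟨⟨0, hE0⟩⟩
  have hev : ∀ᶠ n : ℕ in atTop, ⨅ j, wassersteinDist (empiricalMeasure σ z n) (μs j) < 2 * ε := by
    refine eventually_lt_of_limsup_lt (hlim.trans_lt (by linarith)) ?_
    refine isBoundedUnder_of_eventually_le (a := 1) ?_
    filter_upwards [eventually_ne_atTop 0] with n hn
    have := isProbabilityMeasure_empiricalMeasure σ z hn
    have := hμ ⟨0, hE0⟩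
    exact (ciInf_le (Finite.bddBelow_range _) ⟨0, hE0⟩).trans
      (wassersteinDist_le_one Subshift.dist_le_one _ _)
  obtain ⟨n₀, hn₀⟩ := eventually_atTop.mp hev
  obtain ⟨n₁, hn₁⟩ := exists_nat_gt (C / (w / 4))
  have key : ∀ r : Fin d → Fin (Q + 1), ∃ (T : ℕ) (j : Fin E), T ≠ 0 ∧ C < T * (w / 4) ∧
      wassersteinDist (empiricalMeasure σ z T) (μs j) < 2 * ε ∧ ∀ i : Fin d, ∃ u : ℤ,
      ((Q : ℤ) + 1) ∣ u - (r i : ℕ) ∧ |shiftSum (F i) z.1 0 T - u * (T * w)| ≤ C := by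
    intro r
    obtain ⟨T, hT, hu⟩ := h r (max (n₀ + 1) n₁)
    have hT0 : n₀ + 1 ≤ T := (le_max_left _ _).trans hT
    have hT1 : (n₁ : ℝ) ≤ T := by exact_mod_cast (le_max_right _ _).trans hT
    obtain ⟨j, hj⟩ := exists_eq_ciInf_of_finite
      (f := fun j => wassersteinDist (empiricalMeasure σ z T) (μs j))
    refine ⟨T, j, by omega, ?_, ?_, hu⟩
    · rw [← div_lt_iff₀ (by positivity)]; linarith
    · have := hn₀ T (by omega)
      rw [← hj] at this
      exact this
  choose T j hT0 hTC hW hu using key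
  have hinj : Function.Injective j := by
    intro r r' hrr
    by_contra hne
    obtain ⟨i, hi⟩ := Function.ne_iff.mp hne
    obtain ⟨u, hdu, hcu⟩ := hu r i
    obtain ⟨u', hdu', hcu'⟩ := hu r' i
    have huu : u ≠ u' := by
      rintro rfl
      have h1 : ((Q : ℤ) + 1) ∣ ((r i : ℕ) : ℤ) - ((r' i : ℕ) : ℤ) := by
        have := dvd_sub hdu' hdu
        rwa [sub_sub_sub_cancel_left] at this
      have h2 := (r i).isLt
      have h3 := (r' i).isLt
      have h4 : ((r i : ℕ) : ℤ) - ((r' i : ℕ) : ℤ) = 0 := by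
        refine Int.eq_zero_of_abs_lt_dvd h1 ?_
        rw [abs_lt]; constructor <;> omega
      exact hi (Fin.ext (by omega))
    have havg : ∀ (S : ℕ) (v : ℤ), S ≠ 0 → C < S * (w / 4) →
        |shiftSum (F i) z.1 0 S - v * (S * w)| ≤ C →
        |shiftSum (F i) z.1 0 S / S - v * w| < w / 4 := by
      intro S v hS hSC hle
      have hS' : (0 : ℝ) < S := by exact_mod_cast Nat.pos_of_ne_zero hS
      have : shiftSum (F i) z.1 0 S / S - v * w =
          (shiftSum (F i) z.1 0 S - v * (S * w)) / S := by
        field_simp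
      rw [this, abs_div, abs_of_pos hS', div_lt_iff₀ hS']
      linarith
    have hmu : ∀ S : ℕ, S ≠ 0 → wassersteinDist (empiricalMeasure σ z S) (μs (j r)) < 2 * ε →
        |shiftSum (F i) z.1 0 S / S - ∫ x, F i x.1 ∂(μs (j r))| ≤ 2 ^ m * (2 * ε) := by
      intro S hS hlt
      have := isProbabilityMeasure_empiricalMeasure σ z hS
      have := hμ (j r)
      rw [← integral_empiricalMeasure_subshift hσ]
      refine (abs_integral_sub_le_wassersteinDist Subshift.dist_le_one _ _ (by positivity)
        (hF i).measurable_subshift (fun x => (hF i).nonneg _) (fun x => (hF i).le_one _)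
        (hF i).abs_sub_le_dist).trans ?_
      gcongr
    have e1 := havg _ u (hT0 r) (hTC r) hcu
    have e2 := havg _ u' (hT0 r') (hTC r') hcu'
    have e3 := hmu _ (hT0 r) (hW r)
    have e4 := hmu _ (hT0 r') (hrr ▸ hW r')
    have e5 : w ≤ |(u : ℝ) * w - u' * w| := by
      rw [← sub_mul, abs_mul, abs_of_pos hw]
      have : (1 : ℝ) ≤ |(u : ℝ) - u'| := by
        exact_mod_cast Int.one_le_abs (sub_ne_zero.mpr huu)
      nlinarith
    have e6 : |(u : ℝ) * w - u' * w| < w := by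
      rw [abs_lt] at *
      rw [abs_le] at *
      constructor <;> linarith [e1.1, e1.2, e2.1, e2.2, e3.1, e3.2, e4.1, e4.2]
    exact absurd e5 (not_le.mpr e6)
  simpa using Fintype.card_le_of_injective j hinj

theorem superPolynomialEmergence_of_pow_le {X : Type*} [MetricSpace X] [MeasurableSpace X]
    {f : X → X} {x : X} (h : ∀ d : ℕ, ∃ c : ℝ, 0 < c ∧ c < 1 ∧ ∀ Q : ℕ,
      (Q + 1) ^ d ≤ pointwiseEmergence f x (c / (Q + 1))) : superPolynomialEmergence f x := by
  rw [superPolynomialEmergence, EReal.eq_top_iff_forall_lt]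
  intro a
  obtain ⟨d, hd⟩ := exists_nat_gt (2 * a)
  obtain ⟨c, hc0, hc1, hc⟩ := h d
  have hlt : (a : EReal) < ((d / 2 : ℝ) : EReal) := EReal.coe_lt_coe_iff.mpr (by linarith)
  refine hlt.trans_le (le_limsup_of_frequently_le ?_)
  have htend : Tendsto (fun Q : ℕ => c / ((Q : ℝ) + 1)) atTop (nhdsWithin 0 (Set.Ioi 0)) := by
    refine tendsto_nhdsWithin_iff.mpr ⟨?_, Eventually.of_forall fun Q => ?_⟩
    · exact tendsto_const_nhds.div_atTop
        (tendsto_atTop_add_const_right _ _ tendsto_natCast_atTop_atTop)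
    · exact div_pos hc0 (by positivity)
  refine htend.frequently (Eventually.frequently ?_)
  obtain ⟨Q₀, hQ₀⟩ := exists_nat_gt (1 / c)
  filter_upwards [eventually_ge_atTop Q₀] with Q hQ
  rw [EReal.coe_le_coe_iff]
  have hQ1 : (0 : ℝ) < (Q : ℝ) + 1 := by positivity
  have hQc : 1 / c ≤ (Q : ℝ) + 1 := by
    have : (Q₀ : ℝ) ≤ Q := by exact_mod_cast hQ
    linarith
  have hlogc : -Real.log c ≤ Real.log ((Q : ℝ) + 1) := by
    rw [← Real.log_inv, ← one_div]
    exact Real.log_le_log (by positivity) hQc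
  have hlogQ : 0 ≤ Real.log ((Q : ℝ) + 1) :=
    Real.log_nonneg (by linarith [Nat.cast_nonneg (α := ℝ) Q])
  have hlogc0 : Real.log c < 0 := Real.log_neg hc0 hc1
  have hloge : -Real.log (c / ((Q : ℝ) + 1)) = Real.log ((Q : ℝ) + 1) - Real.log c := by
    rw [Real.log_div hc0.ne' hQ1.ne']; ring
  rw [hloge, le_div_iff₀ (by linarith)]
  have hpow : (d : ℝ) * Real.log ((Q : ℝ) + 1) ≤
      Real.log (pointwiseEmergence f x (c / (Q + 1))) := by
    rw [← Real.log_pow]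
    exact Real.log_le_log (by positivity) (by exact_mod_cast hc Q)
  have hd0 : (0 : ℝ) ≤ d := Nat.cast_nonneg d
  nlinarith

theorem exists_recurrent_schedule : ∃ (dd QQ : ℕ → ℕ) (rr : ℕ → ℕ → ℕ),
    ∀ (d Q : ℕ) (r : Fin d → ℕ) (K : ℕ), ∃ k ≥ K, dd k = d ∧ QQ k = Q ∧
      ∀ i : Fin d, rr k i = r i := by
  obtain ⟨e, he⟩ := exists_surjective_nat (ℕ × ℕ × List ℕ)
  refine ⟨fun k => (e k.unpair.1).1, fun k => (e k.unpair.1).2.1,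
    fun k i => (e k.unpair.1).2.2.getD i 0, fun d Q r K => ?_⟩
  obtain ⟨a, ha⟩ := he (d, Q, List.ofFn r)
  refine ⟨Nat.pair a K, Nat.right_le_pair a K, ?_⟩
  simp [Nat.unpair_pair, ha]

/-- Every path can be thinly interspersed with inserted words, at places that do not depend on it,
so as to become a point of super-polynomial emergence. -/
theorem exists_superPolynomialEmergence_insertion {κ : ℕ} (hκ : 2 ≤ κ)
    {A : Matrix (Fin κ) (Fin κ) ℕ} {N : ℕ} (hN : 1 ≤ N) (hc : ∀ n, N ≤ n → ConnectsIn A n)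
    {σ : Subshift A → Subshift A} (hσ : ∀ x, (σ x).1 = fun n => x.1 (n + 1)) {M : ℕ}
    (hM : 1 ≤ M) : ∃ pos : ℕ → ℕ, (∀ j, M * pos j ≤ (M + 1) * j) ∧
      ∀ x : Subshift A, ∃ z, superPolynomialEmergence σ z ∧ ∀ j, z.1 (pos j) = x.1 j := by
  obtain ⟨y, hy, hsep⟩ := exists_disjoint_periodic_family hκ hN hc
  choose m hm using hsep
  obtain ⟨dd, QQ, rr, hsched⟩ := exists_recurrent_schedule
  obtain ⟨pos, hpos, hins⟩ := exists_insertion hN (hc N le_rfl) hy hm hM dd QQ rr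
  refine ⟨pos, hpos, fun x => ?_⟩
  obtain ⟨z, hz, hzx, hcount⟩ := hins x.1 x.2
  refine ⟨⟨z, hz⟩, superPolynomialEmergence_of_pow_le fun d => ?_, hzx⟩
  have hM0 : (0 : ℝ) ≤ M := Nat.cast_nonneg M
  have hd0 : (0 : ℝ) ≤ d := Nat.cast_nonneg d
  have hden : (1 : ℝ) ≤ 2 * (M + 1) * (d + 1) := by nlinarith
  have h2 : (1 : ℝ) ≤ 2 ^ m d := one_le_pow₀ (by norm_num)
  refine ⟨1 / (2 * (M + 1) * (d + 1)) / (2 ^ m d * 8), by positivity, ?_, fun Q => ?_⟩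
  · rw [div_div, div_lt_one (by positivity)]
    nlinarith
  refine pow_le_pointwiseEmergence hσ ⟨z, hz⟩ (m := m d)
    (F := fun i => orbitIndicator (m d) (y i)) (fun i => isLocal_orbitIndicator _ _)
    (w := 1 / (2 * (M + 1) * (d + 1) * (Q + 1))) (C := (d + 4) * (N + m d)) (by positivity)
    (by positivity) (le_of_eq (by field_simp; norm_num)) fun r n₀ => ?_
  obtain ⟨k, hk, hdk, hQk, hrk⟩ := hsched d Q (fun i => (r i : ℕ)) n₀
  refine ⟨stageTime M N k, by have := le_stageTime (M := M) hN k; omega, fun i => ?_⟩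
  have := hcount k i (by rw [hdk]; exact i.isLt)
  rw [hdk, hQk, hrk i] at this
  simpa only [mul_one_div] using this

theorem bowenEntropy_mono {X : Type*} [MetricSpace X] (f : X → X) {S S' : Set X} (h : S ⊆ S') :
    bowenEntropy f S ≤ bowenEntropy f S' := by
  refine iSup₂_mono fun ε _ => ?_
  refine le_iInf₂ fun s hs => iInf₂_le s ?_
  refine le_antisymm (le_trans ?_ hs.le) zero_le
  refine iSup_mono fun N => ?_
  refine le_iInf₂ fun I hI => le_iInf₂ fun hIN hcov => ?_
  exact iInf₂_le_of_le I hI (iInf₂_le_of_le hIN (h.trans hcov) le_rfl)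

theorem Subshift.apply_eq_of_mem_bowenBall {κ : ℕ} {A : Matrix (Fin κ) (Fin κ) ℕ}
    {σ : Subshift A → Subshift A} (hσ : ∀ x, (σ x).1 = fun n => x.1 (n + 1))
    {x y : Subshift A} {n : ℕ} (h : y ∈ bowenBall σ x n 1) {l : ℕ} (hl : l < n) :
    x.1 l = y.1 l := by
  have h1 : dist (σ^[l] x).1 (σ^[l] y).1 < (1 / 2 : ℝ) ^ 0 := by
    rw [pow_zero]; exact h l hl
  have h2 := PiNat.apply_eq_of_dist_lt h1 le_rfl
  simpa [Subshift.iterate_apply hσ] using h2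

theorem Subshift.mem_bowenBall {κ : ℕ} {A : Matrix (Fin κ) (Fin κ) ℕ}
    {σ : Subshift A → Subshift A} (hσ : ∀ x, (σ x).1 = fun n => x.1 (n + 1))
    {x y : Subshift A} {n m : ℕ} {ε : ℝ} (hm : (1 / 2) ^ m < ε)
    (h : 0 < n → ∀ l < n + m, x.1 l = y.1 l) : y ∈ bowenBall σ x n ε := by
  intro k hk
  refine (Subshift.dist_le_iff.mpr fun l hl => ?_).trans_lt hm
  simp only [Subshift.iterate_apply hσ]
  exact h (by omega) _ (by omega)

/-- If every path `x` can be read off from some `z ∈ S` along places of density `M / (M + 1)`,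
then covers of `S` yield covers of the whole space. -/
theorem Subshift.bowenPreMeasure_univ_eq_zero {κ : ℕ} {A : Matrix (Fin κ) (Fin κ) ℕ}
    {σ : Subshift A → Subshift A} (hσ : ∀ x, (σ x).1 = fun n => x.1 (n + 1))
    {S : Set (Subshift A)} {M : ℕ} (hM : 1 ≤ M) {pos : ℕ → ℕ}
    (hpos : ∀ j, M * pos j ≤ (M + 1) * j)
    (hS : ∀ x : Subshift A, ∃ z ∈ S, ∀ j, z.1 (pos j) = x.1 j) {s ε : ℝ} (hs : 0 ≤ s)
    (hε : 0 < ε) (h : bowenPreMeasure σ S s 1 = 0) :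
    bowenPreMeasure σ Set.univ (s * ((M + 1) / M)) ε = 0 := by
  classical
  have hM' : (0 : ℝ) < M := by exact_mod_cast hM
  obtain ⟨m, hm⟩ := exists_pow_lt_of_lt_one hε (one_half_lt_one (α := ℝ))
  choose Φ hΦS hΦ using hS
  set s' : ℝ := s * ((M + 1) / M) with hs'
  have hs'0 : 0 ≤ s' := by positivity
  set K : ENNReal := ENNReal.ofReal (Real.exp (s' * (m + 1)))
  have hK0 : K ≠ 0 := by
    rw [ENNReal.ofReal_ne_zero_iff]; exact Real.exp_pos _
  have hKtop : K ≠ ⊤ := ENNReal.ofReal_ne_top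
  rw [bowenPreMeasure, ENNReal.iSup_eq_zero] at h ⊢
  intro N₀
  have hN₁ := h ((M + 1) * (N₀ + m))
  set inf := ⨅ (I : Set (Subshift A × ℕ)) (_ : I.Countable) (_ : ∀ p ∈ I, N₀ ≤ p.2)
      (_ : Set.univ ⊆ ⋃ p ∈ I, bowenBall σ p.1 p.2 ε),
    ∑' p : I, ENNReal.ofReal (Real.exp (-(s' * ((p : Subshift A × ℕ).2 : ℝ)))) with hinf
  suffices hle : inf / K ≤ 0 by
    have := le_antisymm hle zero_le
    rw [ENNReal.div_eq_zero_iff] at this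
    exact this.resolve_right hKtop
  rw [← hN₁]
  refine le_iInf₂ fun I hI => le_iInf₂ fun hIN hcov => ?_
  rw [ENNReal.div_le_iff' hK0 hKtop]
  let g : Subshift A × ℕ → Subshift A × ℕ := fun p =>
    (if h : ∃ x, Φ x ∈ bowenBall σ p.1 p.2 1 then h.choose else p.1, M * p.2 / (M + 1) - m)
  have hgN : ∀ p ∈ g '' I, N₀ ≤ p.2 := by
    rintro _ ⟨p, hp, rfl⟩
    have h1 : N₀ + m ≤ M * p.2 / (M + 1) := by
      rw [Nat.le_div_iff_mul_le (show 0 < M + 1 by omega)]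
      calc (N₀ + m) * (M + 1) = (M + 1) * (N₀ + m) := mul_comm _ _
        _ ≤ p.2 := hIN p hp
        _ ≤ M * p.2 := Nat.le_mul_of_pos_left _ hM
    simp only [g]
    omega
  have hgcov : Set.univ ⊆ ⋃ p ∈ g '' I, bowenBall σ p.1 p.2 ε := by
    intro x _
    obtain ⟨p, hp, hxp⟩ := Set.mem_iUnion₂.mp (hcov (hΦS x))
    refine Set.mem_iUnion₂.mpr ⟨g p, ⟨p, hp, rfl⟩, ?_⟩
    have hex : ∃ x, Φ x ∈ bowenBall σ p.1 p.2 1 := ⟨x, hxp⟩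
    simp only [g, dif_pos hex]
    refine Subshift.mem_bowenBall hσ hm fun hpos' l hl => ?_
    have hl' : (l + 1) * (M + 1) ≤ M * p.2 := by
      rw [← Nat.le_div_iff_mul_le (show 0 < M + 1 by omega)]; omega
    have hlt : pos l < p.2 := by
      have h1 : M * pos l < M * p.2 := by nlinarith [hpos l]
      exact lt_of_mul_lt_mul_left h1 (Nat.zero_le M)
    calc hex.choose.1 l = (Φ hex.choose).1 (pos l) := (hΦ _ l).symm
      _ = p.1.1 (pos l) := (Subshift.apply_eq_of_mem_bowenBall hσ hex.choose_spec hlt).symm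
      _ = (Φ x).1 (pos l) := Subshift.apply_eq_of_mem_bowenBall hσ hxp hlt
      _ = x.1 l := hΦ x l
  refine (iInf₂_le_of_le (g '' I) (hI.image g) (iInf₂_le_of_le hgN hgcov le_rfl)).trans ?_
  refine (ENNReal.tsum_le_tsum_comp_of_surjective
    (f := fun p : I => (⟨g p, p, p.2, rfl⟩ : g '' I)) ?_ _).trans ?_
  · rintro ⟨_, p, hp, rfl⟩
    exact ⟨⟨p, hp⟩, rfl⟩
  rw [← ENNReal.tsum_mul_left]
  refine ENNReal.tsum_le_tsum fun p => ?_
  rw [← ENNReal.ofReal_mul (Real.exp_pos _).le, ← Real.exp_add]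
  refine ENNReal.ofReal_le_ofReal (Real.exp_le_exp.mpr ?_)
  have hlow : (M : ℝ) * (p : Subshift A × ℕ).2 / (M + 1) - 1 - m ≤ ((g p).2 : ℝ) := by
    have h1 : M * (p : Subshift A × ℕ).2 ≤ (M + 1) * ((g p).2 + m + 1) := by
      have := Nat.lt_mul_div_succ (M * (p : Subshift A × ℕ).2) (show 0 < M + 1 by omega)
      refine this.le.trans (Nat.mul_le_mul_left _ ?_)
      simp only [g]
      omega
    have h2 : (M : ℝ) * (p : Subshift A × ℕ).2 ≤ (M + 1) * ((g p).2 + m + 1) := by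
      exact_mod_cast h1
    rw [sub_sub, sub_le_iff_le_add, div_le_iff₀ (by positivity)]
    linarith
  have h3 := mul_le_mul_of_nonneg_left hlow hs'0
  have h4 : s' * ((M : ℝ) * (p : Subshift A × ℕ).2 / (M + 1) - 1 - m) =
      s * (p : Subshift A × ℕ).2 - s' * (m + 1) := by
    rw [hs']; field_simp; ring
  linarith

theorem Subshift.bowenEntropy_univ_le {κ : ℕ} {A : Matrix (Fin κ) (Fin κ) ℕ}
    {σ : Subshift A → Subshift A} (hσ : ∀ x, (σ x).1 = fun n => x.1 (n + 1))
    {S : Set (Subshift A)} {M : ℕ} (hM : 1 ≤ M) {pos : ℕ → ℕ}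
    (hpos : ∀ j, M * pos j ≤ (M + 1) * j)
    (hS : ∀ x : Subshift A, ∃ z ∈ S, ∀ j, z.1 (pos j) = x.1 j) :
    bowenEntropy σ Set.univ ≤ ENNReal.ofReal (((M : ℝ) + 1) / M) * bowenEntropy σ S := by
  have hM' : (0 : ℝ) < M := by exact_mod_cast hM
  set c : ENNReal := ENNReal.ofReal (((M : ℝ) + 1) / M) with hc
  have hc0 : c ≠ 0 := by rw [hc, ENNReal.ofReal_ne_zero_iff]; positivity
  refine iSup₂_le fun ε hε => ?_
  rw [← ENNReal.div_le_iff' hc0 ENNReal.ofReal_ne_top]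
  refine le_trans ?_ (le_iSup₂ (f := fun (ε : ℝ) (_ : 0 < ε) =>
    ⨅ (s : NNReal) (_ : bowenPreMeasure σ S s ε = 0), (s : ENNReal)) 1 one_pos)
  refine le_iInf₂ fun s hs => ?_
  rw [ENNReal.div_le_iff' hc0 ENNReal.ofReal_ne_top]
  have h0 := Subshift.bowenPreMeasure_univ_eq_zero hσ hM hpos hS s.2 hε hs
  refine (iInf₂_le (s * (((M : ℝ) + 1) / M).toNNReal) ?_).trans ?_
  · rw [NNReal.coe_mul, Real.coe_toNNReal _ (by positivity)]
    exact h0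
  · rw [ENNReal.coe_mul, mul_comm]
    exact le_rfl

/-- Let `κ ≥ 2`, let `X ⊆ {1,…,κ}^ℕ` be a topologically mixing subshift of
finite type (determined by a 0-1 transition matrix `A`), and let `σ : X → X` be the left
shift. Then the set `ℰ_σ` of points with super-polynomial pointwise emergence carries full
topological entropy: `h_top(σ|_{ℰ_σ}) = h_top(σ|_X)`. -/
theorem highEmergence_full_entropy_subshift
    (κ : ℕ) (hκ : 2 ≤ κ) (A : Matrix (Fin κ) (Fin κ) ℕ)
    (hA : ∀ i j, A i j = 0 ∨ A i j = 1)
    (hmix : ∃ N : ℕ, 1 ≤ N ∧ ∀ n, N ≤ n → ∀ i j, 0 < (A ^ n) i j)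
    (σ : {x : ℕ → Fin κ // ∀ n, A (x n) (x (n + 1)) = 1} →
      {x : ℕ → Fin κ // ∀ n, A (x n) (x (n + 1)) = 1})
    (hσ : ∀ x, (σ x).1 = fun n => x.1 (n + 1)) :
    bowenEntropy σ {x | superPolynomialEmergence σ x} = bowenEntropy σ Set.univ := by
  obtain ⟨N, hN, hpos⟩ := hmix
  have hc : ∀ n, N ≤ n → ConnectsIn A n := fun n hn => connectsIn_of_pow_pos hA (hpos n hn)
  refine le_antisymm (bowenEntropy_mono σ (subset_univ _)) ?_
  set H := bowenEntropy σ {x | superPolynomialEmergence σ x}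
  have hlim : Tendsto (fun M : ℕ => ENNReal.ofReal ((((M + 1 : ℕ) : ℝ) + 1) / (M + 1 : ℕ)) * H)
      atTop (nhds (1 * H)) := by
    refine ENNReal.Tendsto.mul_const ?_ (Or.inl one_ne_zero)
    rw [← ENNReal.ofReal_one]
    refine ENNReal.tendsto_ofReal ?_
    have h1 : Tendsto (fun M : ℕ => 1 + 1 / ((M : ℝ) + 1)) atTop (nhds (1 + 0)) :=
      tendsto_const_nhds.add tendsto_one_div_add_atTop_nhds_zero_nat
    rw [add_zero] at h1
    refine h1.congr fun M => ?_
    push_cast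
    field_simp
  rw [← one_mul H]
  refine ge_of_tendsto' hlim fun M => ?_
  obtain ⟨pos, hdens, hins⟩ :=
    exists_superPolynomialEmergence_insertion hκ hN hc hσ (M := M + 1) (Nat.succ_pos M)
  exact Subshift.bowenEntropy_univ_le hσ (Nat.succ_pos M) hdens hins
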